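/- Let S be a finite set of nonnegative integers and R a set of nonnegative integers such that every nonnegative integer can be written uniquely as s + r with s ∈ S, r ∈ R. Let U be a finite set of nonnegative integers of odd cardinality. Then the number of nonnegative integers m for which the number of pairs (s, u) ∈ S × U with s + u = m is odd, is at least |S|. Equivalently, the symmetric difference of the translates S + u over u ∈ U has size at least |S|. -/

import Mathlib

/-- Every large `m` is `f + r` with `r ∈ R` and `f` represented an odd number of times. -/
theorem cover_aux (S : Finset ℕ) (R : Set ℕ)
    (htile : ∀ m : ℕ, ∃! p : ℕ × ℕ, p.1 ∈ S ∧ p.2 ∈ R ∧ p.1 + p.2 = m)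
    (U : Finset ℕ) (hUodd : Odd U.card) (m : ℕ) (hm : ∀ u ∈ U, u ≤ m) :
    ∃ r ∈ R, r ≤ m ∧ Odd (((S ×ˢ U).filter fun p => p.1 + p.2 = m - r).card) := by
  classical
  by_contra hcon
  push Not at hcon
  let T : Finset ((ℕ × ℕ) × ℕ) :=
    ((S ×ˢ U) ×ˢ ((Finset.range (m + 1)).filter (· ∈ R))).filter
      fun q => q.1.1 + q.1.2 + q.2 = m
  have h1 : T.card = U.card := by
    have hmap : ∀ q ∈ T, q.1.2 ∈ U := by
      intro q hq
      simp only [T, Finset.mem_filter, Finset.mem_product] at hq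
      exact hq.1.1.2
    rw [Finset.card_eq_sum_card_fiberwise (s := T) (f := fun q : (ℕ × ℕ) × ℕ => q.1.2) (t := U)
      (fun q hq => hmap q hq)]
    rw [Finset.card_eq_sum_ones]
    refine Finset.sum_congr rfl fun u hu => ?_
    obtain ⟨⟨s, r⟩, ⟨hs, hr, hsr⟩, huniq⟩ := htile (m - u)
    have hum := hm u hu
    simp only at hs hr hsr
    rw [Finset.card_eq_one]
    refine ⟨((s, u), r), ?_⟩
    ext ⟨⟨s', u'⟩, r'⟩
    simp only [T, Finset.mem_filter, Finset.mem_product, Finset.mem_range,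
      Finset.mem_singleton, Prod.mk.injEq]
    constructor
    · rintro ⟨⟨⟨⟨a, b⟩, c, d⟩, e⟩, rfl⟩
      have := huniq (s', r') ⟨a, d, by simp only; omega⟩
      simp only [Prod.mk.injEq] at this
      exact ⟨⟨this.1, rfl⟩, this.2⟩
    · rintro ⟨⟨rfl, rfl⟩, rfl⟩
      exact ⟨⟨⟨⟨hs, hu⟩, by omega, hr⟩, by omega⟩, rfl⟩
  have h2 : Even T.card := by
    have hmap : ∀ q ∈ T, q.2 ∈ (Finset.range (m + 1)).filter (· ∈ R) := by
      intro q hq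
      simp only [T, Finset.mem_filter, Finset.mem_product] at hq ⊢
      exact hq.1.2
    rw [Finset.card_eq_sum_card_fiberwise (s := T) (f := fun q : (ℕ × ℕ) × ℕ => q.2)
      (t := (Finset.range (m + 1)).filter (· ∈ R)) (fun q hq => hmap q hq)]
    refine Finset.even_sum _ fun r hr => ?_
    simp only [Finset.mem_filter, Finset.mem_range] at hr
    have h3 := hcon r hr.2 (by omega)
    rw [Nat.not_odd_iff_even] at h3
    refine (congrArg Even ?_).mpr h3
    refine Finset.card_bij (fun q _ => q.1) ?_ ?_ ?_
    · rintro ⟨⟨s', u'⟩, r'⟩ h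
      simp only [T, Finset.mem_filter, Finset.mem_product, Finset.mem_range] at h ⊢
      exact ⟨h.1.1.1, by omega⟩
    · rintro ⟨p, r'⟩ h ⟨p', r''⟩ h' e
      simp only [Finset.mem_filter] at h h'
      simp only at e
      rw [e, h.2, h'.2]
    · rintro ⟨s', u'⟩ h
      simp only [Finset.mem_filter, Finset.mem_product] at h
      refine ⟨((s', u'), r), ?_, rfl⟩
      simp only [T, Finset.mem_filter, Finset.mem_product, Finset.mem_range]
      exact ⟨⟨⟨h.1, by omega, hr.2⟩, by omega⟩, trivial⟩
  rw [h1] at h2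
  exact (Nat.not_even_iff_odd.mpr hUodd) h2

/-- If `(S, R)` is a direct-sum tiling of `ℕ` and `U` is a finite set of naturals of
odd cardinality, then the symmetric difference of the translates `S + u` (`u ∈ U`),
i.e. the set of `m` represented as `s + u` an odd number of times, has size at
least `|S|`. -/
theorem symmDiff_translates_card_ge (S : Finset ℕ) (R : Set ℕ)
    (htile : ∀ m : ℕ, ∃! p : ℕ × ℕ, p.1 ∈ S ∧ p.2 ∈ R ∧ p.1 + p.2 = m)
    (U : Finset ℕ) (hUodd : Odd U.card) :
    S.card ≤ Set.ncard {m : ℕ | Odd (((S ×ˢ U).filter fun p => p.1 + p.2 = m).card)} := by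
  classical
  have hfin : {m : ℕ | Odd (((S ×ˢ U).filter fun p => p.1 + p.2 = m).card)}.Finite := by
    refine ((S ×ˢ U).image fun p => p.1 + p.2).finite_toSet.subset ?_
    intro m hm
    obtain ⟨p, hp⟩ := Finset.card_pos.mp (Odd.pos hm)
    rw [Finset.mem_filter] at hp
    exact Finset.mem_coe.mpr (Finset.mem_image.mpr ⟨p, hp⟩)
  rw [Set.ncard_eq_toFinset_card _ hfin]
  set F := hfin.toFinset with hF
  by_contra! hlt
  set K := U.sup id with hK
  set L := S.sup id with hL
  set w := F.card with hw
  set M := w * (K + L) + 1 with hM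
  set P := (Finset.range (K + M)).filter (· ∈ R) with hP
  have hcov : M ≤ w * P.card := by
    have : Finset.Ico K (K + M) ⊆ (F ×ˢ P).image fun p => p.1 + p.2 := by
      intro m hm
      rw [Finset.mem_Ico] at hm
      obtain ⟨r, hr, hrm, ho⟩ := cover_aux S R htile U hUodd m
        (fun u hu => (Finset.le_sup (f := id) hu).trans hm.1)
      refine Finset.mem_image.mpr ⟨(m - r, r), ?_, by simp only; omega⟩
      refine Finset.mem_product.mpr ⟨hfin.mem_toFinset.mpr ho, ?_⟩
      exact Finset.mem_filter.mpr ⟨Finset.mem_range.mpr (by simp only; omega), hr⟩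
    have := (Finset.card_le_card this).trans Finset.card_image_le
    rw [Finset.card_product, Nat.card_Ico, Nat.add_sub_cancel_left] at this
    exact this
  have hpack : S.card * P.card ≤ K + M + L := by
    rw [← Finset.card_product, ← Finset.card_range (K + M + L)]
    refine Finset.card_le_card_of_injOn (fun p => p.1 + p.2) ?_ ?_
    · rintro ⟨s, r⟩ h
      simp only [Finset.coe_product, Set.mem_prod, Finset.mem_coe, hP, Finset.mem_filter,
        Finset.mem_range] at h
      have : s ≤ L := Finset.le_sup (f := id) h.1
      simp only [Finset.coe_range, Set.mem_Iio]
      omega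
    · rintro ⟨s, r⟩ h ⟨s', r'⟩ h' e
      simp only [Finset.coe_product, Set.mem_prod, Finset.mem_coe, hP, Finset.mem_filter,
        Finset.mem_range] at h h' e
      exact (htile (s + r)).unique ⟨h.1, h.2.2, rfl⟩ ⟨h'.1, h'.2.2, e.symm⟩
  have h1 : M * S.card ≤ w * (K + M + L) :=
    calc M * S.card ≤ w * P.card * S.card := Nat.mul_le_mul_right _ hcov
      _ = w * (S.card * P.card) := by ring
      _ ≤ _ := Nat.mul_le_mul_left _ hpack
  have h2 : M * (w + 1) ≤ M * S.card := Nat.mul_le_mul_left _ hlt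
  have h3 : w * (K + M + L) = w * (K + L) + M * w := by ring
  have h4 : M * (w + 1) = M * w + M := by ring
  omega
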